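/- arXiv:1111.5448 — 3 statements merged into one kernel-verified Lean document; each statement's English description precedes it below -/
import Mathlib

section
/- Let A and F be pointed protomodular categories and let F : A → F be a functor preserving the zero object. Then F is protoadditive if and only if F preserves all pullbacks along split epimorphisms. -/
open CategoryTheory CategoryTheory.Limits

universe v u v₂ u₂

namespace ProtoPaper

variable {C : Type u} [Category.{v} C]

section ZeroDefs

variable [HasZeroMorphisms C]

/-- `k` is a kernel of `f`. -/
def IsKernelOf {K A B : C} (k : K ⟶ A) (f : A ⟶ B) : Prop :=
  ∃ w : k ≫ f = 0, Nonempty (IsLimit (KernelFork.ofι k w))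

/-- `f` is a cokernel of `k`. -/
def IsCokernelOf {K A B : C} (f : A ⟶ B) (k : K ⟶ A) : Prop :=
  ∃ w : k ≫ f = 0, Nonempty (IsColimit (CokernelCofork.ofπ f w))

/-- A normal monomorphism: a kernel of some morphism. -/
def IsNormalMonoArrow {K A : C} (k : K ⟶ A) : Prop :=
  ∃ (B : C) (f : A ⟶ B), IsKernelOf k f

/-- A normal epimorphism: a cokernel of some morphism. -/
def IsNormalEpiArrow {A B : C} (f : A ⟶ B) : Prop :=
  ∃ (K : C) (k : K ⟶ A), IsCokernelOf f k

/-- A split short exact sequence `0 → K → A ⇄ B → 0`. -/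
structure IsSplitShortExact {K A B : C} (k : K ⟶ A) (f : A ⟶ B) (s : B ⟶ A) : Prop where
  isKernel : IsKernelOf k f
  split : s ≫ f = 𝟙 B

/-- A short exact sequence `0 → K → A → B → 0`. -/
structure IsShortExact {K A B : C} (k : K ⟶ A) (f : A ⟶ B) : Prop where
  isKernel : IsKernelOf k f
  isCokernel : IsCokernelOf f k

/-- A protosplit monomorphism: a kernel of a split epimorphism. -/
def IsProtosplitMono {K A : C} (k : K ⟶ A) : Prop :=
  ∃ (B : C) (f : A ⟶ B) (s : B ⟶ A), IsSplitShortExact k f s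

end ZeroDefs

/-- A pointed category is protomodular when the split short five lemma holds. -/
def IsProtomodular (C : Type u) [Category.{v} C] [HasZeroMorphisms C] : Prop :=
  ∀ ⦃K A B K' A' B' : C⦄ (k : K ⟶ A) (f : A ⟶ B) (s : B ⟶ A)
    (k' : K' ⟶ A') (f' : A' ⟶ B') (s' : B' ⟶ A')
    (κ : K ⟶ K') (α : A ⟶ A') (β : B ⟶ B'),
    IsSplitShortExact k f s → IsSplitShortExact k' f' s' →
    k ≫ α = κ ≫ k' → f ≫ β = α ≫ f' → s ≫ α = β ≫ s' →
    IsIso κ → IsIso β → IsIso α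

section Functors

variable {D : Type u₂} [Category.{v₂} D]

/-- A functor is protoadditive if it preserves split short exact sequences. -/
def IsProtoadditive [HasZeroMorphisms C] [HasZeroMorphisms D] (F : C ⥤ D) : Prop :=
  ∀ ⦃K A B : C⦄ (k : K ⟶ A) (f : A ⟶ B) (s : B ⟶ A),
    IsSplitShortExact k f s → IsSplitShortExact (F.map k) (F.map f) (F.map s)

/-- A functor preserves zero objects. -/
def PreservesZeroObjects (F : C ⥤ D) : Prop :=
  ∀ X : C, IsZero X → IsZero (F.obj X)

/-- A functor preserves pullbacks along split epimorphisms. -/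
def PreservesPullbacksAlongSplitEpis (F : C ⥤ D) : Prop :=
  ∀ ⦃P X Y Z : C⦄ (fst : P ⟶ X) (snd : P ⟶ Y) (f : X ⟶ Z) (g : Y ⟶ Z),
    IsSplitEpi f → IsPullback fst snd f g →
    IsPullback (F.map fst) (F.map snd) (F.map f) (F.map g)

end Functors

/-- A homological category: pointed, protomodular and regular (finitely complete with
pullback-stable (regular epi, mono) factorisations). -/
structure IsHomological (C : Type u) [Category.{v} C] [HasZeroObject C]
    [HasZeroMorphisms C] : Prop where
  protomodular : IsProtomodular C
  hasFiniteLimits : HasFiniteLimits C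
  regEpiMonoFac : ∀ ⦃X Y : C⦄ (f : X ⟶ Y),
    ∃ (I : C) (e : X ⟶ I) (m : I ⟶ Y), Nonempty (RegularEpi e) ∧ Mono m ∧ e ≫ m = f
  regEpiStable : ∀ ⦃P X Y Z : C⦄ (fst : P ⟶ X) (snd : P ⟶ Y) (f : X ⟶ Z) (g : Y ⟶ Z),
    IsPullback fst snd f g → Nonempty (RegularEpi f) → Nonempty (RegularEpi snd)

/-- An internal equivalence relation, given by a jointly monic pair which is internally
reflexive, symmetric and transitive. -/
structure IsInternalEquivRel {R X : C} (p₁ p₂ : R ⟶ X) : Prop where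
  jointlyMono : ∀ ⦃Z : C⦄ (a b : Z ⟶ R), a ≫ p₁ = b ≫ p₁ → a ≫ p₂ = b ≫ p₂ → a = b
  refl : ∃ d : X ⟶ R, d ≫ p₁ = 𝟙 X ∧ d ≫ p₂ = 𝟙 X
  symm : ∃ σ : R ⟶ R, σ ≫ p₁ = p₂ ∧ σ ≫ p₂ = p₁
  trans : ∀ ⦃P : C⦄ (q₁ q₂ : P ⟶ R), IsPullback q₁ q₂ p₂ p₁ →
    ∃ t : P ⟶ R, t ≫ p₁ = q₁ ≫ p₁ ∧ t ≫ p₂ = q₂ ≫ p₂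

/-- A semi-abelian category: homological, with binary coproducts, and exact
(every internal equivalence relation is a kernel pair). -/
structure IsSemiAbelian (C : Type u) [Category.{v} C] [HasZeroObject C]
    [HasZeroMorphisms C] : Prop where
  homological : IsHomological C
  hasBinaryCoproducts : HasBinaryCoproducts C
  equivRelEffective : ∀ ⦃R X : C⦄ (p₁ p₂ : R ⟶ X), IsInternalEquivRel p₁ p₂ →
    ∃ (Y : C) (f : X ⟶ Y), IsPullback p₁ p₂ f f

/-- A full subcategory (given by a predicate on objects) is replete if it is closed
under isomorphisms. -/
def Replete (P : C → Prop) : Prop := ∀ ⦃X Y : C⦄, P X → (X ≅ Y) → P Y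

/-- A reflection of `C` onto the full subcategory of objects satisfying `P`:
a reflector `F`, a unit `η`, landing in `P`, with the usual universal property. -/
structure Reflection (C : Type u) [Category.{v} C] (P : C → Prop) where
  F : C ⥤ C
  η : 𝟭 C ⟶ F
  mem : ∀ X : C, P (F.obj X)
  univ : ∀ ⦃X B : C⦄, P B → ∀ f : X ⟶ B, ∃! g : F.obj X ⟶ B, η.app X ≫ g = f

variable {P : C → Prop}

/-- A (normal epi)-reflection: all units are normal epimorphisms. -/
def NormalEpiUnits [HasZeroMorphisms C] (R : Reflection C P) : Prop :=
  ∀ X : C, IsNormalEpiArrow (R.η.app X)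

/-- `f` is a trivial extension with respect to the reflection `R`. -/
def IsTrivialExt (R : Reflection C P) {A B : C} (f : A ⟶ B) : Prop :=
  IsPullback (R.η.app A) f (R.F.map f) (R.η.app B)

/-- `p` is an effective descent morphism: the pullback functor between the slice
categories is monadic. -/
def IsEffectiveDescent [HasPullbacks C] {E B : C} (p : E ⟶ B) : Prop :=
  Nonempty (MonadicRightAdjoint (Over.pullback p))

/-- A central extension with respect to the (absolute) Galois structure of a reflection:
some pullback along an effective descent morphism is a trivial extension. -/
def IsCentralExt [HasPullbacks C] (R : Reflection C P) {A B : C} (f : A ⟶ B) : Prop :=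
  ∃ (E : C) (p : E ⟶ B), IsEffectiveDescent p ∧
    ∃ (Pb : C) (p1 : Pb ⟶ E) (p2 : Pb ⟶ A), IsPullback p1 p2 p f ∧ IsTrivialExt R p1

/-- A normal extension with respect to the (absolute) Galois structure of a reflection. -/
def IsNormalExt [HasPullbacks C] (R : Reflection C P) {A B : C} (f : A ⟶ B) : Prop :=
  IsEffectiveDescent f ∧
    ∃ (Pb : C) (p1 p2 : Pb ⟶ A), IsPullback p1 p2 f f ∧ IsTrivialExt R p1

/-- A central extension with respect to the Galois structure of a reflection relative to
the class of normal epimorphisms. -/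
def IsCentralExtN [HasZeroMorphisms C] (R : Reflection C P) {A B : C} (f : A ⟶ B) : Prop :=
  IsNormalEpiArrow f ∧ ∃ (E : C) (p : E ⟶ B), IsNormalEpiArrow p ∧
    ∃ (Pb : C) (p1 : Pb ⟶ E) (p2 : Pb ⟶ A), IsPullback p1 p2 p f ∧ IsTrivialExt R p1

/-- A normal extension with respect to the Galois structure of a reflection relative to
the class of normal epimorphisms. -/
def IsNormalExtN [HasZeroMorphisms C] (R : Reflection C P) {A B : C} (f : A ⟶ B) : Prop :=
  IsNormalEpiArrow f ∧
    ∃ (Pb : C) (p1 p2 : Pb ⟶ A), IsPullback p1 p2 f f ∧ IsTrivialExt R p1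

/-- The reflector is semi-left-exact: it preserves pullbacks of units along morphisms
with domain in the subcategory. -/
def SemiLeftExact (R : Reflection C P) : Prop :=
  ∀ ⦃A X Pb : C⦄ (x : X ⟶ R.F.obj A) (p1 : Pb ⟶ A) (p2 : Pb ⟶ X), P X →
    IsPullback p1 p2 (R.η.app A) x →
    IsPullback (R.F.map p1) (R.F.map p2) (R.F.map (R.η.app A)) (R.F.map x)

/-- The reflector has stable units: it preserves pullbacks of units along arbitrary
morphisms. -/
def StableUnits (R : Reflection C P) : Prop :=
  ∀ ⦃A X Pb : C⦄ (x : X ⟶ R.F.obj A) (p1 : Pb ⟶ A) (p2 : Pb ⟶ X),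
    IsPullback p1 p2 (R.η.app A) x →
    IsPullback (R.F.map p1) (R.F.map p2) (R.F.map (R.η.app A)) (R.F.map x)

/-- The reflection is admissible with respect to the class of normal epimorphisms:
the reflector preserves pullbacks of units along normal epimorphisms with domain in
the subcategory. -/
def AdmissibleN [HasZeroMorphisms C] (R : Reflection C P) : Prop :=
  ∀ ⦃A X Pb : C⦄ (x : X ⟶ R.F.obj A) (p1 : Pb ⟶ A) (p2 : Pb ⟶ X), P X →
    IsNormalEpiArrow x →
    IsPullback p1 p2 (R.η.app A) x →
    IsPullback (R.F.map p1) (R.F.map p2) (R.F.map (R.η.app A)) (R.F.map x)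

/-- The radical associated to a (normal epi)-reflection is idempotent. -/
def IdempotentRadical [HasZeroMorphisms C] (R : Reflection C P) : Prop :=
  ∀ ⦃A TA : C⦄ (t : TA ⟶ A), IsKernelOf t (R.η.app A) →
    ∀ ⦃T2 : C⦄ (t2 : T2 ⟶ TA), IsKernelOf t2 (R.η.app TA) → IsIso t2

/-- Condition (N) for a (normal epi)-reflection: for any morphism `f` with kernel
`k : K ⟶ A`, and any kernel `t : TK ⟶ K` of the unit at `K`, the composite `t ≫ k`
is a normal monomorphism. -/
def ConditionN [HasZeroMorphisms C] (R : Reflection C P) : Prop :=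
  ∀ ⦃A B : C⦄ (f : A ⟶ B) ⦃K : C⦄ (k : K ⟶ A), IsKernelOf k f →
    ∀ ⦃TK : C⦄ (t : TK ⟶ K), IsKernelOf t (R.η.app K) → IsNormalMonoArrow (t ≫ k)

/-- A torsion theory on a pointed category, given by a pair of full replete
subcategories. -/
structure TorsionTheory (C : Type u) [Category.{v} C] [HasZeroMorphisms C]
    (T F : C → Prop) : Prop where
  repleteT : Replete T
  repleteF : Replete F
  hom_zero : ∀ ⦃X Y : C⦄ (f : X ⟶ Y), T X → F Y → f = 0
  exists_ses : ∀ A : C, ∃ (TA FA : C) (t : TA ⟶ A) (q : A ⟶ FA),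
    T TA ∧ F FA ∧ IsShortExact t q

/-- Condition (N) for a torsion theory, formulated without reference to a chosen
reflector: for any morphism `f` with kernel `k : K ⟶ A` and any short exact sequence
`0 → TK → K → FK → 0` with `TK` torsion and `FK` torsion-free, the composite
`TK → A` is a normal monomorphism. -/
def TTConditionN [HasZeroMorphisms C] (T F : C → Prop) : Prop :=
  ∀ ⦃A B K TK FK : C⦄ (f : A ⟶ B) (k : K ⟶ A) (t : TK ⟶ K) (q : K ⟶ FK),
    IsKernelOf k f → T TK → F FK → IsShortExact t q → IsNormalMonoArrow (t ≫ k)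

/-- Condition (P) for a torsion theory: the torsion-free reflector is protoadditive
(formulated for every (normal epi)-reflection onto the torsion-free part). -/
def TTConditionP [HasZeroMorphisms C] (T F : C → Prop) : Prop :=
  ∀ R : Reflection C F, NormalEpiUnits R → IsProtoadditive R.F

/-- Orthogonality `e ↓ m` of two morphisms. -/
def Orthogonal {A B X Y : C} (e : A ⟶ B) (m : X ⟶ Y) : Prop :=
  ∀ (a : A ⟶ X) (b : B ⟶ Y), e ≫ b = a ≫ m →
    ∃! d : B ⟶ X, e ≫ d = a ∧ d ≫ m = b

/-- The class of morphisms orthogonal on the right to all members of `E`. -/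
def dnOrth (E : MorphismProperty C) : MorphismProperty C :=
  fun _ _ m => ∀ ⦃A B : C⦄ (e : A ⟶ B), E e → Orthogonal e m

/-- The class of morphisms orthogonal on the left to all members of `M`. -/
def upOrth (M : MorphismProperty C) : MorphismProperty C :=
  fun _ _ e => ∀ ⦃X Y : C⦄ (m : X ⟶ Y), M m → Orthogonal e m

/-- A prefactorisation system. -/
structure IsPrefactorisationSystem (E M : MorphismProperty C) : Prop where
  E_eq : E = upOrth M
  M_eq : M = dnOrth E

/-- A factorisation system. -/
structure IsFactorisationSystem (E M : MorphismProperty C) : Prop where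
  E_eq : E = upOrth M
  M_eq : M = dnOrth E
  fac : ∀ ⦃X Y : C⦄ (f : X ⟶ Y),
    ∃ (I : C) (e : X ⟶ I) (m : I ⟶ Y), E e ∧ M m ∧ e ≫ m = f

/-- A pullback-stable class of morphisms. -/
def PullbackStable (E : MorphismProperty C) : Prop :=
  ∀ ⦃P X Y Z : C⦄ (fst : P ⟶ X) (snd : P ⟶ Y) (f : X ⟶ Z) (g : Y ⟶ Z),
    IsPullback fst snd f g → E f → E snd

/-- The class of morphisms inverted by the reflector. -/
def invertedByR (R : Reflection C P) : MorphismProperty C :=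
  fun _ _ f => IsIso (R.F.map f)

/-- The class of morphisms all of whose pullbacks lie in `E` ("stably in `E`"). -/
def StablyIn (E : MorphismProperty C) : MorphismProperty C :=
  fun _ Y e => ∀ ⦃Pb W : C⦄ (fst : Pb ⟶ W) (snd : Pb ⟶ _) (g : W ⟶ Y),
    IsPullback fst snd g e → E fst

/-- The class of morphisms locally in `M`: some pullback along an effective descent
morphism lies in `M`. -/
def locallyIn [HasPullbacks C] (M : MorphismProperty C) : MorphismProperty C :=
  fun _ B f => ∃ (E : C) (p : E ⟶ B), IsEffectiveDescent p ∧
    ∃ (Pb : C) (p1 : Pb ⟶ E) (p2 : Pb ⟶ _), IsPullback p1 p2 p f ∧ M p1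

/-- The class `Ē` associated to a torsion theory: normal epimorphisms with torsion
kernel. -/
def Ebar [HasZeroMorphisms C] (T : C → Prop) : MorphismProperty C :=
  fun X _ e => IsNormalEpiArrow e ∧ ∃ (K : C) (k : K ⟶ X), IsKernelOf k e ∧ T K

/-- The class `M̄` associated to a torsion theory: morphisms with torsion-free
kernel. -/
def Mbar [HasZeroMorphisms C] (F : C → Prop) : MorphismProperty C :=
  fun X _ m => ∃ (K : C) (k : K ⟶ X), IsKernelOf k m ∧ F K

/-- A Birkhoff subcategory: a (regular epi)-reflective subcategory such that the
naturality squares of the unit at regular epimorphisms are pushouts. -/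
structure IsBirkhoff [HasZeroMorphisms C] (R : Reflection C P) : Prop where
  units_regEpi : ∀ X : C, Nonempty (RegularEpi (R.η.app X))
  pushout_units : ∀ ⦃A B : C⦄ (f : A ⟶ B), Nonempty (RegularEpi f) →
    IsPushout f (R.η.app A) (R.η.app B) (R.F.map f)

section ArrowInstances

variable [HasZeroMorphisms C]

instance instZeroArrowHom (f g : Arrow C) : Zero (f ⟶ g) :=
  ⟨{ left := 0, right := 0, w := by simp }⟩

@[simp] lemma arrowHomZero_left (f g : Arrow C) : (0 : f ⟶ g).left = 0 := rfl

@[simp] lemma arrowHomZero_right (f g : Arrow C) : (0 : f ⟶ g).right = 0 := rfl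

instance instArrowHasZeroMorphisms : HasZeroMorphisms (Arrow C) where
  comp_zero {X Y} f Z := by
    apply CommaMorphism.ext <;> simp
  zero_comp X {Y Z} f := by
    apply CommaMorphism.ext <;> simp

end ArrowInstances

lemma isKernelOf_iff [HasZeroMorphisms C] {K A B : C} (k : K ⟶ A) (f : A ⟶ B) :
    IsKernelOf k f ↔ k ≫ f = 0 ∧ ∀ ⦃W : C⦄ (h : W ⟶ A), h ≫ f = 0 → ∃! l : W ⟶ K, l ≫ k = h := by
  constructor
  · rintro ⟨w, ⟨hl⟩⟩
    refine ⟨w, fun W h hh => ?_⟩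
    obtain ⟨l, hl'⟩ := KernelFork.IsLimit.lift' hl h hh
    refine ⟨l, hl', fun m hm => ?_⟩
    apply Fork.IsLimit.hom_ext hl
    exact hm.trans hl'.symm
  · rintro ⟨w, H⟩
    choose l hl hu using H
    exact ⟨w, ⟨KernelFork.IsLimit.ofι k w (fun g hg => l g hg) (fun g hg => hl g hg)
      (fun g hg m hm => hu g hg m hm)⟩⟩

lemma isKernelOf_pullback_iff [HasZeroMorphisms C] {P X Y Z K : C} {fst : P ⟶ X} {snd : P ⟶ Y}
    {f : X ⟶ Z} {g : Y ⟶ Z} (h : IsPullback fst snd f g) (k : K ⟶ P) (hk : k ≫ snd = 0) :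
    IsKernelOf k snd ↔ IsKernelOf (k ≫ fst) f := by
  rw [isKernelOf_iff, isKernelOf_iff]
  constructor
  · rintro ⟨-, H⟩
    refine ⟨by rw [Category.assoc, h.w, reassoc_of% hk, zero_comp], fun W a ha => ?_⟩
    obtain ⟨l, hl, hu⟩ := H (h.lift a 0 (by rw [ha, zero_comp])) (by simp)
    refine ⟨l, by simp only []; rw [reassoc_of% hl, h.lift_fst], fun m hm => hu m ?_⟩
    apply h.hom_ext
    · simpa using hm
    · simp [hk]
  · rintro ⟨-, H⟩
    refine ⟨hk, fun W a ha => ?_⟩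
    obtain ⟨l, hl, hu⟩ := H (a ≫ fst) (by rw [Category.assoc, h.w, reassoc_of% ha, zero_comp])
    refine ⟨l, ?_, fun m hm => hu m ?_⟩
    · apply h.hom_ext
      · simpa using hl
      · simp [hk, ha]
    · simp only [] at hm ⊢
      rw [← hm, Category.assoc]

lemma isKernelOf_iff_isPullback [HasZeroMorphisms C] {K A B Z : C} (k : K ⟶ A) (f : A ⟶ B)
    (hZ : IsZero Z) (a : K ⟶ Z) (b : Z ⟶ B) : IsKernelOf k f ↔ IsPullback k a f b := by
  have hb : b = 0 := hZ.eq_of_src _ _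
  rw [isKernelOf_iff]
  constructor
  · rintro ⟨w, H⟩
    choose l hl hu using H
    have hs : ∀ s : PullbackCone f b, s.fst ≫ f = 0 := fun s => by
      exact s.condition.trans ((congrArg (s.snd ≫ ·) hb).trans comp_zero)
    exact ⟨⟨by rw [w, hb, comp_zero]⟩, ⟨PullbackCone.IsLimit.mk _ (fun s => l s.fst (hs s))
      (fun s => hl _ _) (fun s => hZ.eq_of_tgt _ _) (fun s m hm _ => hu _ (hs s) m hm)⟩⟩
  · intro h
    refine ⟨by rw [h.w, hb, comp_zero], fun W x hx => ?_⟩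
    refine ⟨h.lift x 0 (by rw [hx, zero_comp]), h.lift_fst _ _ _, fun m hm => ?_⟩
    apply h.hom_ext
    · simpa using hm
    · exact hZ.eq_of_tgt _ _

/-- Proposition 2.2. Let `A` and `B` be pointed protomodular categories
(with pullbacks along split epimorphisms) and `F : A ⥤ B` a functor preserving the zero
object. Then `F` is protoadditive if and only if it preserves pullbacks along split
epimorphisms. -/
theorem statement0 {A : Type u} [Category.{v} A] [HasZeroObject A] [HasZeroMorphisms A]
    {B : Type u₂} [Category.{v₂} B] [HasZeroObject B] [HasZeroMorphisms B]
    (hA : IsProtomodular A) (hB : IsProtomodular B)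
    (hpbA : ∀ ⦃X Y Z : A⦄ (f : X ⟶ Z) (g : Y ⟶ Z), IsSplitEpi f →
      ∃ (P : A) (p1 : P ⟶ X) (p2 : P ⟶ Y), IsPullback p1 p2 f g)
    (hpbB : ∀ ⦃X Y Z : B⦄ (f : X ⟶ Z) (g : Y ⟶ Z), IsSplitEpi f →
      ∃ (P : B) (p1 : P ⟶ X) (p2 : P ⟶ Y), IsPullback p1 p2 f g)
    (F : A ⥤ B) (hz : PreservesZeroObjects F) :
    IsProtoadditive F ↔ PreservesPullbacksAlongSplitEpis F := by
  obtain ⟨O, hO⟩ := HasZeroObject.zero (C := A)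
  constructor
  · intro hF P X Y Z fst snd f g hf h
    obtain ⟨⟨t, ht⟩⟩ := hf
    obtain ⟨s, hs1, hs2⟩ : ∃ s : Y ⟶ P, s ≫ fst = g ≫ t ∧ s ≫ snd = 𝟙 Y :=
      ⟨h.lift (g ≫ t) (𝟙 Y) (by simp [ht]), h.lift_fst _ _ _, h.lift_snd _ _ _⟩
    obtain ⟨K, k, z, hk⟩ := hpbA snd (0 : O ⟶ Y) ⟨⟨⟨s, hs2⟩⟩⟩
    have hk1 : IsKernelOf k snd := (isKernelOf_iff_isPullback _ _ hO z 0).2 hk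
    have hk2 : IsKernelOf (k ≫ fst) f := (isKernelOf_pullback_iff h k hk1.1).1 hk1
    have e1 := hF k snd s ⟨hk1, hs2⟩
    have e2 := hF (k ≫ fst) f t ⟨hk2, ht⟩
    obtain ⟨Q, q1, q2, hQ⟩ := hpbB (F.map f) (F.map g) ⟨⟨⟨F.map t, e2.split⟩⟩⟩
    obtain ⟨c, hc1, hc2⟩ : ∃ c : F.obj P ⟶ Q, c ≫ q1 = F.map fst ∧ c ≫ q2 = F.map snd :=
      ⟨hQ.lift (F.map fst) (F.map snd) (by rw [← F.map_comp, h.w, F.map_comp]),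
        hQ.lift_fst _ _ _, hQ.lift_snd _ _ _⟩
    have hkc : (F.map k ≫ c) ≫ q2 = 0 := by rw [Category.assoc, hc2]; exact e1.isKernel.1
    have hker : IsKernelOf (F.map k ≫ c) q2 := by
      rw [isKernelOf_pullback_iff hQ _ hkc, Category.assoc, hc1, ← F.map_comp]
      exact e2.isKernel
    have hci : IsIso c := hB (F.map k) (F.map snd) (F.map s) (F.map k ≫ c) q2 (F.map s ≫ c)
      (𝟙 _) c (𝟙 _) e1 ⟨hker, by rw [Category.assoc, hc2]; exact e1.split⟩
      (by simp) (by simp [hc2]) (by simp) inferInstance inferInstance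
    exact hQ.of_iso (asIso c).symm (Iso.refl _) (Iso.refl _) (Iso.refl _)
      (by simp [← hc1]) (by simp [← hc2]) (by simp) (by simp)
  · intro hF K X Y k f s h
    have hs : F.map s ≫ F.map f = 𝟙 _ := by rw [← F.map_comp, h.split, F.map_id]
    refine ⟨?_, hs⟩
    have hp := (isKernelOf_iff_isPullback k f hO 0 0).1 h.isKernel
    exact (isKernelOf_iff_isPullback _ _ (hz _ hO) _ _).2
      (hF _ _ _ _ ⟨⟨⟨s, h.split⟩⟩⟩ hp)

end ProtoPaper
end

section
/- Let A be a homological category and F : A → F the reflector onto a full replete (normal epi)-reflective subcategory F of A, with associated radical T : A → A. Then F is protoadditive if and only if T is protoadditive. -/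
open CategoryTheory CategoryTheory.Limits

universe v u v₂ u₂

namespace ProtoPaper

variable {C : Type u} [Category.{v} C]

variable {P : C → Prop}

section Helpers

variable [HasZeroMorphisms C]

lemma IsKernelOf.zero {K A B : C} {k : K ⟶ A} {f : A ⟶ B} (h : IsKernelOf k f) :
    k ≫ f = 0 := h.1

lemma IsKernelOf.mono {K A B : C} {k : K ⟶ A} {f : A ⟶ B} (h : IsKernelOf k f) :
    Mono k := by
  obtain ⟨w, ⟨hl⟩⟩ := h
  exact ⟨fun a b hab => Fork.IsLimit.hom_ext hl hab⟩

lemma IsKernelOf.lift {K A B : C} {k : K ⟶ A} {f : A ⟶ B} (h : IsKernelOf k f)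
    {Z : C} (x : Z ⟶ A) (hx : x ≫ f = 0) : ∃ y : Z ⟶ K, y ≫ k = x := by
  obtain ⟨w, ⟨hl⟩⟩ := h
  exact ⟨_, (KernelFork.IsLimit.lift' hl x hx).2⟩

lemma IsKernelOf.mk' {K A B : C} {k : K ⟶ A} {f : A ⟶ B} (w : k ≫ f = 0) (hk : Mono k)
    (h : ∀ ⦃Z : C⦄ (x : Z ⟶ A), x ≫ f = 0 → ∃ y : Z ⟶ K, y ≫ k = x) : IsKernelOf k f :=
  ⟨w, ⟨KernelFork.IsLimit.ofι' k w fun x hx => ⟨(h x hx).choose, (h x hx).choose_spec⟩⟩⟩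

lemma IsNormalEpiArrow.regEpi {A B : C} {f : A ⟶ B} (h : IsNormalEpiArrow f) :
    Nonempty (RegularEpi f) := by
  obtain ⟨K, k, w, ⟨hc⟩⟩ := h
  exact ⟨{ W := K, left := k, right := 0, w := by rw [w, zero_comp], isColimit := hc }⟩

lemma strongEpi_of_regEpi {A B : C} {f : A ⟶ B} (h : Nonempty (RegularEpi f)) :
    StrongEpi f := by
  have : IsRegularEpi f := ⟨h⟩
  infer_instance

/-- A regular epimorphism followed by an isomorphism is a regular epimorphism. -/
noncomputable def regEpi_of_iso {X Y Z : C} {e : X ⟶ Y} (r : RegularEpi e) (m : Y ⟶ Z) [IsIso m]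
    {g : X ⟶ Z} (h : e ≫ m = g) : RegularEpi g :=
  RegularEpi.ofArrowIso (f := e) (g := g)
    (Arrow.isoMk (f := Arrow.mk e) (g := Arrow.mk g) (Iso.refl X) (@asIso C _ Y Z m _)
      (by simp [h])) r

/-- The kernel of a pullback of `p`. -/
lemma kernel_of_pullback {W X Y Z N : C} {a : W ⟶ X} {b : W ⟶ Y} {p : X ⟶ Z} {q : Y ⟶ Z}
    (h : IsPullback a b p q) {n : N ⟶ X} (hn : IsKernelOf n p) {n' : N ⟶ W}
    (h1 : n' ≫ a = n) (h2 : n' ≫ b = 0) : IsKernelOf n' b := by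
  have := hn.mono
  refine IsKernelOf.mk' h2 (mono_of_mono_fac h1) fun V x hx => ?_
  obtain ⟨y, hy⟩ := hn.lift (x ≫ a) (by
    rw [Category.assoc, h.w, ← Category.assoc, hx, zero_comp])
  exact ⟨y, h.hom_ext (by rw [Category.assoc, h1, hy]) (by rw [Category.assoc, h2, comp_zero, hx])⟩

lemma isIso_of_regEpi_kernel [HasZeroObject C] (hC : IsHomological C)
    {M Y Q N : C} {m : M ⟶ Q} {p : Y ⟶ Q} {i : M ⟶ Y} (hi : Mono i) (hip : i ≫ p = m)
    (hm : Nonempty (RegularEpi m)) {j : N ⟶ Y} (hj : IsKernelOf j p)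
    {j' : N ⟶ M} (hjj : j' ≫ i = j) : IsIso i := by
  have := hC.hasFiniteLimits
  have hj' : IsKernelOf j' m := by
    have := hj.mono
    refine IsKernelOf.mk' ?_ (mono_of_mono_fac hjj) fun V x hx => ?_
    · rw [← hip, ← Category.assoc, hjj, hj.zero]
    · obtain ⟨y, hy⟩ := hj.lift (x ≫ i) (by rw [Category.assoc, hip, hx])
      exact ⟨y, by rw [← cancel_mono i, Category.assoc, hjj, hy]⟩
  have P1 := IsPullback.of_hasPullback m m
  have P2 := IsPullback.of_hasPullback p m
  obtain ⟨n1, h11, h12⟩ := P1.exists_lift j' (0 : N ⟶ M) (by rw [hj'.zero, zero_comp])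
  obtain ⟨n2, h21, h22⟩ := P2.exists_lift j (0 : N ⟶ M) (by rw [hj.zero, zero_comp])
  obtain ⟨s1, s11, s12⟩ := P1.exists_lift (𝟙 M) (𝟙 M) rfl
  obtain ⟨s2, s21, s22⟩ := P2.exists_lift i (𝟙 M) (by rw [hip, Category.id_comp])
  obtain ⟨a, a1, a2⟩ := P2.exists_lift (pullback.fst m m ≫ i) (pullback.snd m m)
    (by rw [Category.assoc, hip, P1.w])
  have k1 := kernel_of_pullback P1 hj' h11 h12
  have k2 := kernel_of_pullback P2 hj h21 h22
  have : IsIso a := hC.protomodular n1 _ s1 n2 _ s2 (𝟙 N) a (𝟙 M) ⟨k1, s12⟩ ⟨k2, s22⟩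
    (P2.hom_ext
      (by rw [Category.assoc, a1, ← Category.assoc, h11, hjj, Category.assoc, h21,
            Category.id_comp])
      (by rw [Category.assoc, a2, h12, Category.assoc, h22, comp_zero]))
    (by rw [a2, Category.comp_id])
    (P2.hom_ext
      (by rw [Category.assoc, a1, ← Category.assoc, s11, Category.assoc, s21])
      (by rw [Category.assoc, a2, s12, Category.assoc, s22, Category.id_comp]))
    inferInstance inferInstance
  have : StrongEpi ((inv a ≫ pullback.fst m m) ≫ i) := by
    rw [Category.assoc, ← a1, IsIso.inv_hom_id_assoc]
    exact strongEpi_of_regEpi (hC.regEpiStable _ _ _ _ P2.flip hm)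
  have := strongEpi_of_strongEpi (inv a ≫ pullback.fst m m) i
  exact isIso_of_mono_of_strongEpi i

lemma mono_of_zero_kernel [HasZeroObject C] (hC : IsHomological C)
    {X Y : C} {g : X ⟶ Y} (h : ∀ ⦃Z : C⦄ (x : Z ⟶ X), x ≫ g = 0 → x = 0) : Mono g := by
  have := hC.hasFiniteLimits
  have P1 := IsPullback.of_hasPullback g g
  obtain ⟨d, d1, d2⟩ := P1.exists_lift (𝟙 X) (𝟙 X) rfl
  obtain ⟨Z0, hZ0⟩ := HasZeroObject.zero (C := C)
  have hz : ∀ {V : C} (z w : V ⟶ Z0), z = w := fun z w => hZ0.eq_of_tgt z w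
  have k0 : ∀ {A B : C} (f : A ⟶ B), (∀ ⦃Z : C⦄ (x : Z ⟶ A), x ≫ f = 0 → x = 0) →
      IsKernelOf (0 : Z0 ⟶ A) f := fun f hf =>
    IsKernelOf.mk' zero_comp ⟨fun _ _ _ => hz _ _⟩ fun Z x hx => ⟨0, by rw [hf x hx, comp_zero]⟩
  have : IsIso d := hC.protomodular (0 : Z0 ⟶ X) (𝟙 X) (𝟙 X) (0 : Z0 ⟶ _)
    (pullback.snd g g) d (𝟙 _) d (𝟙 X)
    ⟨k0 _ fun Z x hx => by simpa using hx, by simp⟩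
    ⟨k0 _ fun Z x hx => P1.hom_ext (by
      rw [zero_comp]
      apply h
      rw [Category.assoc, P1.w, ← Category.assoc, hx, zero_comp]) (by rw [hx, zero_comp]), d2⟩
    (by simp) (by simp [d2]) (by simp) inferInstance inferInstance
  refine ⟨fun {Z} a b hab => ?_⟩
  obtain ⟨c, c1, c2⟩ := P1.exists_lift a b hab
  have e : pullback.fst g g = pullback.snd g g := by
    rw [← cancel_epi d, d1, d2]
  rw [← c1, ← c2, e]

lemma kernel_core [HasZeroObject C] (hC : IsHomological C)
    {K A B K' A' B' TB : C} {k : K ⟶ A} {f : A ⟶ B} {s : B ⟶ A}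
    (hs : IsSplitShortExact k f s) {k' : K' ⟶ A'} {f' : A' ⟶ B'} {s' : B' ⟶ A'}
    {eK : K ⟶ K'} {eA : A ⟶ A'} {eB : B ⟶ B'}
    (rK : Nonempty (RegularEpi eK)) (rA : Nonempty (RegularEpi eA))
    (ck : eK ≫ k' = k ≫ eA) (cf : eA ≫ f' = f ≫ eB) (cs : eB ≫ s' = s ≫ eA)
    {tB : TB ⟶ B} (hB : IsKernelOf tB eB)
    (H : ∀ ⦃Z : C⦄ (x : Z ⟶ K), x ≫ k ≫ eA = 0 → x ≫ eK = 0) : IsKernelOf k' f' := by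
  have := hC.hasFiniteLimits
  have : StrongEpi eK := strongEpi_of_regEpi rK
  have w : k' ≫ f' = 0 := by
    rw [← cancel_epi eK, ← Category.assoc, ck, Category.assoc, cf, ← Category.assoc,
      hs.isKernel.zero, zero_comp, comp_zero]
  -- the comparison of `A` with the pullback
  have PP := IsPullback.of_hasPullback f' eB
  obtain ⟨q, q1, q2⟩ := PP.exists_lift eA f cf
  obtain ⟨M, e, i, re, mi, hei⟩ := hC.regEpiMonoFac q
  obtain ⟨j, j1, j2⟩ := PP.exists_lift (0 : TB ⟶ A') tB (by rw [hB.zero, zero_comp])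
  have hj : IsKernelOf j (pullback.fst f' eB) := kernel_of_pullback PP.flip hB j2 j1
  have hjq : (tB ≫ s) ≫ q = j := PP.hom_ext
    (by rw [j1, Category.assoc, q1, Category.assoc, ← cs, ← Category.assoc, hB.zero, zero_comp])
    (by rw [j2, Category.assoc, q2, Category.assoc, hs.split, Category.comp_id])
  have rm : Nonempty (RegularEpi (i ≫ pullback.fst f' eB)) := by
    obtain ⟨I, e2, m2, re2, mm2, h2⟩ := hC.regEpiMonoFac (i ≫ pullback.fst f' eB)
    have : StrongEpi ((e ≫ e2) ≫ m2) := by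
      rw [Category.assoc, h2, ← Category.assoc, hei, q1]
      exact strongEpi_of_regEpi rA
    have := strongEpi_of_strongEpi (e ≫ e2) m2
    have : IsIso m2 := isIso_of_mono_of_strongEpi m2
    obtain ⟨r⟩ := re2
    exact ⟨regEpi_of_iso r m2 h2⟩
  have : IsIso i := isIso_of_regEpi_kernel hC mi rfl rm hj (j' := (tB ≫ s) ≫ e)
    (by rw [Category.assoc, hei, hjq])
  have rq : Nonempty (RegularEpi q) := by
    obtain ⟨r⟩ := re
    exact ⟨regEpi_of_iso r i hei⟩
  -- the kernel of the induced split epimorphism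
  have hl : IsKernelOf (kernel.ι f') f' :=
    IsKernelOf.mk' (kernel.condition f') inferInstance
      fun Z x hx => ⟨kernel.lift f' x hx, kernel.lift_ι _ _ _⟩
  obtain ⟨κ, hκ⟩ := hl.lift k' w
  obtain ⟨l, l1, l2⟩ := PP.exists_lift (kernel.ι f') (0 : kernel f' ⟶ B)
    (by rw [hl.zero, zero_comp])
  have sq : IsPullback k (eK ≫ κ) q l := by
    have hw : k ≫ q = (eK ≫ κ) ≫ l := PP.hom_ext
      (by rw [Category.assoc, q1, Category.assoc, l1, Category.assoc, hκ, ck])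
      (by rw [Category.assoc, q2, Category.assoc, l2, comp_zero, hs.isKernel.zero])
    have := hs.isKernel.mono
    have h3 : ∀ c : PullbackCone q l, c.fst ≫ f = 0 := fun c => by
      rw [← q2, ← Category.assoc, c.condition, Category.assoc, l2, comp_zero]
    have h4 := fun c => (hs.isKernel.lift c.fst (h3 c)).choose_spec
    have := hl.mono
    refine ⟨⟨hw⟩, ⟨PullbackCone.IsLimit.mk hw
      (fun c => (hs.isKernel.lift c.fst (h3 c)).choose) h4
      (fun c => ?_) (fun c m h1 h2 => ?_)⟩⟩
    · rw [← cancel_mono (kernel.ι f'), Category.assoc, Category.assoc, hκ, ck,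
        ← Category.assoc, h4, ← q1, ← Category.assoc, c.condition, Category.assoc, l1]
    · rw [← cancel_mono k, h1, h4]
  have : StrongEpi (eK ≫ κ) := strongEpi_of_regEpi (hC.regEpiStable _ _ _ _ sq rq)
  have := strongEpi_of_strongEpi eK κ
  have : Mono κ := by
    refine mono_of_zero_kernel hC fun Z x hx => ?_
    have P3 := IsPullback.of_hasPullback eK x
    have := strongEpi_of_regEpi (hC.regEpiStable _ _ _ _ P3 rK)
    rw [← cancel_epi (pullback.snd eK x), comp_zero, ← P3.w]
    apply H
    rw [← ck, ← hκ, ← Category.assoc, P3.w, Category.assoc, ← Category.assoc x, hx, zero_comp,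
      comp_zero]
  have : IsIso κ := isIso_of_mono_of_strongEpi κ
  have := hl.mono
  refine IsKernelOf.mk' w (by rw [← hκ]; infer_instance) fun Z x hx => ?_
  obtain ⟨y, hy⟩ := hl.lift x hx
  exact ⟨y ≫ inv κ, by rw [← hκ, Category.assoc, IsIso.inv_hom_id_assoc, hy]⟩

end Helpers

/-- Proposition 2.3. Let `C` be a homological category and
`R : C → F` the reflector onto a full replete (normal epi)-reflective subcategory,
with associated radical `T` (given by the kernels of the units). Then the reflector
is protoadditive if and only if the radical is protoadditive. -/
theorem statement1 {C : Type u} [Category.{v} C] [HasZeroObject C] [HasZeroMorphisms C]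
    (hC : IsHomological C) {P : C → Prop} (hrepl : Replete P)
    (R : Reflection C P) (hne : NormalEpiUnits R)
    (T : C ⥤ C) (t : T ⟶ 𝟭 C) (ht : ∀ X : C, IsKernelOf (t.app X) (R.η.app X)) :
    IsProtoadditive R.F ↔ IsProtoadditive T := by
  constructor
  · intro hF K A B k f s h
    have hk := (hF k f s h).isKernel
    refine ⟨?_, by rw [← T.map_comp, h.split, T.map_id]⟩
    have := h.isKernel.mono
    have := hk.mono
    have := fun X => (ht X).mono
    have nk : T.map k ≫ t.app A = t.app K ≫ k := t.naturality k
    have nf : T.map f ≫ t.app B = t.app A ≫ f := t.naturality f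
    have ek : k ≫ R.η.app A = R.η.app K ≫ R.F.map k := R.η.naturality k
    refine IsKernelOf.mk' ?_ ?_ fun Z x hx => ?_
    · rw [← cancel_mono (t.app B), Category.assoc, nf, ← Category.assoc, nk, zero_comp]
      exact (Category.assoc _ _ _).trans (by rw [h.isKernel.zero, comp_zero])
    · have : Mono (T.map k ≫ t.app A) := by rw [nk]; exact mono_comp _ _
      exact mono_of_mono _ (t.app A)
    · obtain ⟨y, hy⟩ := h.isKernel.lift (x ≫ t.app A) (by
        refine (Category.assoc _ _ _).trans ?_
        rw [← nf, ← Category.assoc, hx, zero_comp])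
      obtain ⟨z, hz⟩ := (ht K).lift y (by
        rw [← cancel_mono (R.F.map k), zero_comp]
        refine (Category.assoc _ _ _).trans ?_
        rw [← ek, ← Category.assoc, hy]
        refine (Category.assoc _ _ _).trans ?_
        rw [(ht A).zero, comp_zero])
      refine ⟨z, ?_⟩
      rw [← cancel_mono (t.app A), Category.assoc, nk, ← Category.assoc, hz]
      exact hy
  · intro hT K A B k f s h
    have hk := (hT k f s h).isKernel
    refine ⟨?_, by rw [← R.F.map_comp, h.split, R.F.map_id]⟩
    have := h.isKernel.mono
    have := fun X => (ht X).mono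
    have nk : T.map k ≫ t.app A = t.app K ≫ k := t.naturality k
    have nf : T.map f ≫ t.app B = t.app A ≫ f := t.naturality f
    refine kernel_core hC h (hne K).regEpi (hne A).regEpi (R.η.naturality k).symm
      (R.η.naturality f).symm (R.η.naturality s).symm (ht B) fun Z x hx => ?_
    obtain ⟨y, hy⟩ := (ht A).lift (x ≫ k) ((Category.assoc _ _ _).trans hx)
    obtain ⟨z, hz⟩ := hk.lift y (by
      rw [← cancel_mono (t.app B), Category.assoc, nf, ← Category.assoc, hy, zero_comp]
      exact (Category.assoc _ _ _).trans (by rw [h.isKernel.zero, comp_zero]))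
    have hzx : z ≫ t.app K = x := by
      rw [← cancel_mono k]
      refine (Category.assoc _ _ _).trans ?_
      rw [← nk, ← Category.assoc, hz, hy]
    rw [← hzx]
    exact (Category.assoc _ _ _).trans (by rw [(ht K).zero, comp_zero])

end ProtoPaper
end

section
/- Let F be a full replete reflective subcategory of a pointed protomodular category A whose reflector F : A → F is protoadditive. Then F is closed under split extensions in A: for every split short exact sequence (k : K → A, f : A → B, s) in A, if K ∈ F and B ∈ F then A ∈ F. -/
open CategoryTheory CategoryTheory.Limits

universe v u v₂ u₂

namespace ProtoPaper

variable {C : Type u} [Category.{v} C]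

variable {P : C → Prop}

/-- The unit is an isomorphism at objects of the subcategory. -/
theorem unit_isIso {C : Type u} [Category.{v} C] {P : C → Prop} (R : Reflection C P)
    {X : C} (hX : P X) : IsIso (R.η.app X) := by
  obtain ⟨g, hg, -⟩ := R.univ hX (𝟙 X)
  have hg' : R.η.app X ≫ g = 𝟙 X := hg
  refine ⟨g, hg', ?_⟩
  obtain ⟨u, -, hu⟩ := R.univ (R.mem X) (R.η.app X)
  have h1 : g ≫ R.η.app X = u := hu _ (by
    change R.η.app X ≫ g ≫ R.η.app X = R.η.app X
    rw [← Category.assoc, hg']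
    exact Category.id_comp _)
  have h2 : 𝟙 (R.F.obj X) = u := hu _ (Category.comp_id _)
  exact h1.trans h2.symm

/-- Proposition 2.7. Any full replete reflective subcategory of a
pointed protomodular category with protoadditive reflector is closed under split
extensions. -/
theorem statement4 {C : Type u} [Category.{v} C] [HasZeroObject C] [HasZeroMorphisms C]
    (hC : IsProtomodular C) {P : C → Prop} (hrepl : Replete P)
    (R : Reflection C P) (hproto : IsProtoadditive R.F) :
    ∀ ⦃K A B : C⦄ (k : K ⟶ A) (f : A ⟶ B) (s : B ⟶ A),
      IsSplitShortExact k f s → P K → P B → P A := by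
  intro K A B k f s h hK hB
  have hA : IsIso (R.η.app A) :=
    hC k f s (R.F.map k) (R.F.map f) (R.F.map s) (R.η.app K) (R.η.app A) (R.η.app B)
      h (hproto k f s h) (R.η.naturality k) (R.η.naturality f) (R.η.naturality s)
      (unit_isIso R hK) (unit_isIso R hB)
  exact hrepl (R.mem A) (@asIso _ _ _ _ (R.η.app A) hA).symm

end ProtoPaper
end
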